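/- A convex body in the plane (a nonempty compact convex subset of ℝ²) is indecomposable — i.e., whenever it equals a Minkowski sum K' + K'' of convex bodies, one of the summands is homothetic to it — if and only if it is a point, a line segment, or a triangle. -/

import Mathlib

open scoped Pointwise

/-- A convex body: a nonempty compact convex set. -/
def IsConvexBody {E : Type*} [AddCommGroup E] [Module ℝ E] [TopologicalSpace E]
    (K : Set E) : Prop :=
  K.Nonempty ∧ IsCompact K ∧ Convex ℝ K

/-- `K'` is homothetic to `K`: `K' = λ • K + {t}` for some `λ ≥ 0` and translation `t`. -/
def HomotheticTo {E : Type*} [AddCommGroup E] [Module ℝ E] (K' K : Set E) : Prop :=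
  ∃ (l : ℝ) (t : E), 0 ≤ l ∧ K' = l • K + ({t} : Set E)

/-- `K` is indecomposable: whenever `K = K' + K''` (Minkowski sum of convex bodies),
one of the summands is homothetic to `K`. -/
def Indecomposable {E : Type*} [AddCommGroup E] [Module ℝ E] [TopologicalSpace E]
    (K : Set E) : Prop :=
  ∀ K' K'' : Set E, IsConvexBody K' → IsConvexBody K'' → K = K' + K'' →
    HomotheticTo K' K ∨ HomotheticTo K'' K

section Gen
variable {E : Type*} [AddCommGroup E] [Module ℝ E]

lemma ext_of_open {K : Set E} {e m k : E} (he : e ∈ K.extremePoints ℝ) (hm : m ∈ K) (hk : k ∈ K)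
    {w : ℝ} (h0 : 0 < w) (h1 : w < 1) (h : e = w • m + (1 - w) • k) : m = e ∧ k = e := by
  rw [mem_extremePoints] at he
  exact he.2 m hm k hk ⟨w, 1 - w, h0, by linarith, by ring, h.symm⟩

lemma ext3 {K : Set E} (hK : Convex ℝ K) {e p q r : E} (he : e ∈ K.extremePoints ℝ) (hp : p ∈ K)
    (hq : q ∈ K) (hr : r ∈ K) {v w : ℝ} (hv : 0 ≤ v) (hw : 0 ≤ w) (hvw : v + w < 1)
    (h : e = v • p + w • q + (1 - v - w) • r) : r = e := by
  rcases eq_or_lt_of_le (add_nonneg hv hw) with h0 | h0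
  · have hv0 : v = 0 := by linarith
    have hw0 : w = 0 := by linarith
    subst hv0 hw0
    simpa using h.symm
  · have hm : (v / (v + w)) • p + (w / (v + w)) • q ∈ K :=
      hK hp hq (by positivity) (by positivity) (by field_simp)
    refine (ext_of_open he hm hr h0 hvw ?_).2
    rw [h]
    match_scalars <;> field_simp
    ring

lemma online {K : Set E} {b c m : E} (hb : b ∈ K.extremePoints ℝ)
    (hc : c ∈ K.extremePoints ℝ) (hm : m ∈ K) {τ : ℝ} (h : m = b + τ • (c - b)) (u : E →ₗ[ℝ] ℝ) :
    u m ≤ max (u b) (u c) := by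
  have hum : u m = u b + τ * (u c - u b) := by rw [h]; simp
  rcases lt_or_ge τ 0 with h0 | h0
  · have : m = b := by
      have hpos : 0 < 1 - τ := by linarith
      refine (ext_of_open hb hm hc.1 (w := 1 / (1 - τ)) (by positivity) ?_ ?_).1
      · rw [div_lt_one hpos]; linarith
      · rw [h]
        match_scalars <;> field_simp <;> ring
    rw [this]; exact le_max_left _ _
  rcases le_or_gt τ 1 with h1 | h1
  · rw [hum]
    have h2 := le_max_left (u b) (u c)
    have h3 := le_max_right (u b) (u c)
    nlinarith
  · have : m = c := by
      have hpos : 0 < τ := by linarith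
      refine (ext_of_open hc hm hb.1 (w := 1 / τ) (by positivity) ?_ ?_).1
      · rw [div_lt_one hpos]; linarith
      · rw [h]
        match_scalars <;> field_simp <;> ring
    rw [this]; exact le_max_right _ _

lemma cross {K : Set E} (hK : Convex ℝ K) {b c x y n : E} (hb : b ∈ K.extremePoints ℝ)
    (hc : c ∈ K.extremePoints ℝ) (hx : x ∈ K) (hy : y ∈ K) {p p' r r' : ℝ}
    (hp : 0 ≤ p') (hr : 0 ≤ r')
    (h1 : x - b = p • (c - b) + p' • n) (h2 : y - b = r • (c - b) - r' • n) (u : E →ₗ[ℝ] ℝ)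
    (hu : u y ≤ u x) :
    u y ≤ max (u b) (u c) := by
  have h1' : x = b + p • (c - b) + p' • n := by rw [add_assoc, ← h1]; abel
  have h2' : y = b + r • (c - b) - r' • n := by rw [add_sub_assoc, ← h2]; abel
  rcases eq_or_lt_of_le (add_nonneg hp hr) with h0 | h0
  · have hv0 : r' = 0 := by linarith
    subst hv0
    exact online hb hc hy (τ := r) (by simpa using h2') u
  · have hm : (r' / (p' + r')) • x + (p' / (p' + r')) • y ∈ K :=
      hK hx hy (by positivity) (by positivity) (by field_simp; ring)
    have := online hb hc hm (τ := (r' * p + p' * r) / (p' + r')) (by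
      rw [h1', h2']
      match_scalars <;> field_simp <;> ring) u
    refine le_trans ?_ this
    simp only [map_add, map_smul, smul_eq_mul]
    have e : r' / (p' + r') + p' / (p' + r') = 1 := by field_simp; ring
    have : 0 ≤ r' / (p' + r') := by positivity
    have e' : p' / (p' + r') = 1 - r' / (p' + r') := by linarith
    rw [e']
    generalize r' / (p' + r') = q at this
    nlinarith [mul_nonneg this (sub_nonneg.2 hu)]

/-- four extreme points with crossing diagonals -/
structure Cfg (K : Set E) (o a b c d : E) (k l : ℝ) : Prop where
  conv : Convex ℝ K
  ha : a ∈ K.extremePoints ℝ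
  hb : b ∈ K.extremePoints ℝ
  hc : c ∈ K.extremePoints ℝ
  hd : d ∈ K.extremePoints ℝ
  ho : o ∈ K
  ho' : o ∉ K.extremePoints ℝ
  hk : 0 < k
  hl : 0 < l
  hac : c = o - k • (a - o)
  hbd : d = o - l • (b - o)

lemma Cfg.rot {K : Set E} {o a b c d : E} {k l : ℝ} (h : Cfg K o a b c d k l) :
    Cfg K o b c d a l k⁻¹ where
  conv := h.conv
  ha := h.hb
  hb := h.hc
  hc := h.hd
  hd := h.ha
  ho := h.ho
  ho' := h.ho'
  hk := h.hl
  hl := inv_pos.2 h.hk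
  hac := h.hbd
  hbd := by
    have := h.hk
    rw [h.hac]
    match_scalars <;> field_simp <;> ring

lemma Cfg.refl {K : Set E} {o a b c d : E} {k l : ℝ} (h : Cfg K o a b c d k l) :
    Cfg K o b a d c l k where
  conv := h.conv
  ha := h.hb
  hb := h.ha
  hc := h.hd
  hd := h.hc
  ho := h.ho
  ho' := h.ho'
  hk := h.hl
  hl := h.hk
  hac := h.hbd
  hbd := h.hac

/-- the extreme points in the quadrant between `a` and `b` -/
def Arc (K : Set E) (o a b : E) : Set E :=
  {x | x ∈ K.extremePoints ℝ ∧ ∃ s t : ℝ, 0 ≤ s ∧ 0 ≤ t ∧ x = o + s • (a - o) + t • (b - o)}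

lemma Arc.symm {K : Set E} {o a b x : E} (h : x ∈ Arc K o a b) : x ∈ Arc K o b a := by
  obtain ⟨hx, s, t, hs, ht, e⟩ := h
  exact ⟨hx, t, s, ht, hs, by rw [e]; abel⟩

lemma beyond {K : Set E} (hK : Convex ℝ K) {o a b x : E} (ho : o ∈ K)
    (ho' : o ∉ K.extremePoints ℝ) (ha : a ∈ K) (hb : b ∈ K)
    (hx : x ∈ K.extremePoints ℝ) {s t : ℝ} (hs : 0 ≤ s) (ht : 0 ≤ t)
    (e : x = o + s • (a - o) + t • (b - o)) : 1 ≤ s + t := by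
  by_contra hlt
  push Not at hlt
  apply ho'
  rw [ext3 hK hx ha hb ho hs ht hlt (by rw [e]; module)]
  exact hx

section
variable {K : Set E} {o a b c d x y : E} {k l : ℝ}

-- [x,y] × [b,c]
lemma cr1 (h : Cfg K o a b c d k l) (hx : x ∈ Arc K o a b) (hy : y ∈ Arc K o b c) (u : E →ₗ[ℝ] ℝ)
    (hu : u y ≤ u x) : u y ≤ max (u b) (u c) := by
  obtain ⟨hx, s, t, hs, ht, ex⟩ := hx
  obtain ⟨hy, s', t', hs', ht', ey⟩ := hy
  have hk := h.hk
  have h1 := beyond h.conv h.ho h.ho' h.hb.1 h.hc.1 hy hs' ht' ey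
  have h2 : 0 ≤ 1 + s / k - t := by
    by_contra hlt
    push Not at hlt
    have hsk : 0 ≤ s / k := by positivity
    have htp : 0 < t := by linarith
    apply h.ho'
    rw [ext3 h.conv h.hb hx.1 h.hc.1 h.ho (v := 1 / t) (w := s / (t * k)) (by positivity)
      (by positivity) ?_ ?_]
    · exact h.hb
    · have : 1 / t + s / (t * k) = (1 + s / k) / t := by field_simp
      rw [this, div_lt_one htp]; linarith
    · rw [ex, h.hac]
      match_scalars <;> field_simp <;> ring
  refine cross h.conv h.hb h.hc hx.1 hy.1 (n := o - b) (p := -(s / k)) (p' := 1 + s / k - t)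
    (r := t') (r' := s' + t' - 1) h2 (by linarith) ?_ ?_ u hu
  · rw [ex, h.hac]
    match_scalars <;> field_simp <;> ring
  · rw [ey]
    module

-- [x,y] × [c,d]
lemma cr2 (h : Cfg K o a b c d k l) (hx : x ∈ Arc K o a b) (hy : y ∈ Arc K o c d) (u : E →ₗ[ℝ] ℝ)
    (hu : u y ≤ u x) : u y ≤ max (u c) (u d) := by
  obtain ⟨hx, s, t, hs, ht, ex⟩ := hx
  obtain ⟨hy, s', t', hs', ht', ey⟩ := hy
  have hk := h.hk
  have hl := h.hl
  have h1 := beyond h.conv h.ho h.ho' h.hc.1 h.hd.1 hy hs' ht' ey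
  refine cross h.conv h.hc h.hd hx.1 hy.1 (n := o - c) (p := -(t / l)) (p' := 1 + s / k + t / l)
    (r := t') (r' := s' + t' - 1) (by positivity) (by linarith) ?_ ?_ u hu
  · rw [ex, h.hac, h.hbd]
    match_scalars <;> field_simp <;> ring
  · rw [ey]
    module

-- [x,d] × [a,b]
lemma cr3 (h : Cfg K o a b c d k l) (hx : x ∈ Arc K o a b) (u : E →ₗ[ℝ] ℝ)
    (hu : u d ≤ u x) : u d ≤ max (u a) (u b) := by
  obtain ⟨hx, s, t, hs, ht, ex⟩ := hx
  have hl := h.hl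
  have h1 := beyond h.conv h.ho h.ho' h.ha.1 h.hb.1 hx hs ht ex
  refine cross h.conv h.ha h.hb hx.1 h.hd.1 (n := a - o) (p := t) (p' := s + t - 1)
    (r := -l) (r' := 1 + l) (by linarith) (by linarith) ?_ ?_ u hu
  · rw [ex]
    module
  · rw [h.hbd]
    module

-- [x,c] × [b,d]
lemma cr4 (h : Cfg K o a b c d k l) (hx : x ∈ Arc K o a b) (u : E →ₗ[ℝ] ℝ)
    (hu : u c ≤ u x) : u c ≤ max (u b) (u d) := by
  obtain ⟨hx, s, t, hs, ht, ex⟩ := hx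
  have hl := h.hl
  have hk := h.hk
  refine cross h.conv h.hb h.hd hx.1 h.hc.1 (n := a - o) (p := (1 - t) / (1 + l)) (p' := s)
    (r := 1 / (1 + l)) (r' := k) (by linarith) (by linarith) ?_ ?_ u hu
  · rw [ex, h.hbd]
    match_scalars <;> field_simp <;> ring
  · rw [h.hac, h.hbd]
    match_scalars <;> field_simp <;> ring

lemma fwd (h : Cfg K o a b c d k l) (hx : x ∈ Arc K o a b) (hy : y ∈ Arc K o b c) (u : E →ₗ[ℝ] ℝ)
    (hu : ∀ z ∈ K, u z ≤ u x) {c1 c2 c3 c4 : ℝ} (h1 : 0 ≤ c1) (h2 : 0 ≤ c2) (h3 : 0 ≤ c3)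
    (h4 : 0 ≤ c4)
    (hrel : c1 * (u b - u a) + c2 * (u c - u b) + c3 * (u d - u c) + c4 * (u a - u d) = 0) :
    0 ≤ c1 * (u x - u b) + c2 * (u b - u y) := by
  have ua := hu a h.ha.1
  have ub := hu b h.hb.1
  have uc := hu c h.hc.1
  have ud := hu d h.hd.1
  have uy := hu y hy.1.1
  have e1 := cr1 h hx hy u uy
  have e3 := cr3 h hx u ud
  have e4 := cr4 h hx u uc
  rcases le_or_gt (u y) (u b) with hyb | hyb
  · have := mul_nonneg h1 (sub_nonneg.2 ub)
    have := mul_nonneg h2 (sub_nonneg.2 hyb)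
    linarith
  · have g1 : u y ≤ u c := by
      rcases le_max_iff.1 e1 with g | g <;> linarith
    have g2 : u c ≤ u d := by
      rcases le_max_iff.1 e4 with g | g <;> linarith
    have g3 : u d ≤ u a := by
      rcases le_max_iff.1 e3 with g | g <;> linarith
    have := mul_nonneg h1 (sub_nonneg.2 ua)
    have := mul_nonneg h2 (sub_nonneg.2 g1)
    have := mul_nonneg h3 (sub_nonneg.2 g2)
    have := mul_nonneg h4 (sub_nonneg.2 g3)
    linarith

lemma opp (h : Cfg K o a b c d k l) (hx : x ∈ Arc K o a b) (hy : y ∈ Arc K o c d) (u : E →ₗ[ℝ] ℝ)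
    (hu : ∀ z ∈ K, u z ≤ u x) {c1 c2 c3 c4 : ℝ} (h1 : 0 ≤ c1) (h2 : 0 ≤ c2) (h3 : 0 ≤ c3)
    (h4 : 0 ≤ c4)
    (hrel : c1 * (u b - u a) + c2 * (u c - u b) + c3 * (u d - u c) + c4 * (u a - u d) = 0) :
    0 ≤ c1 * (u x - u b) + c2 * (u b - u c) + c3 * (u c - u y) := by
  have ua := hu a h.ha.1
  have ub := hu b h.hb.1
  have uc := hu c h.hc.1
  have ud := hu d h.hd.1
  have uy := hu y hy.1.1
  have e2 := cr2 h hx hy u uy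
  have e3 := cr3 h hx u ud
  have e4 := cr4 h hx u uc
  have e5 := cr4 h.refl (Arc.symm hx) u ud
  by_cases hg : u c ≤ u b ∧ u y ≤ u c
  · have := mul_nonneg h1 (sub_nonneg.2 ub)
    have := mul_nonneg h2 (sub_nonneg.2 hg.1)
    have := mul_nonneg h3 (sub_nonneg.2 hg.2)
    linarith
  · have g : u y ≤ u d ∧ u d ≤ u a := by
      rw [le_max_iff] at e2 e3 e4 e5
      grind
    have := mul_nonneg h1 (sub_nonneg.2 ua)
    have := mul_nonneg h3 (sub_nonneg.2 g.1)
    have := mul_nonneg h4 (sub_nonneg.2 g.2)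
    linarith
end
end Gen
section Gen2
variable {E : Type*} [AddCommGroup E] [Module ℝ E]

/-- the piecewise homothety -/
def Rl (K : Set E) (o a b c d : E) (c1 c2 c3 c4 : ℝ) (e x z : E) : Prop :=
  (x ∈ Arc K o a b ∧ z = e + c1 • (x - b)) ∨ (x ∈ Arc K o b c ∧ z = e + c2 • (x - b)) ∨
  (x ∈ Arc K o c d ∧ z = e + c2 • (c - b) + c3 • (x - c)) ∨
  (x ∈ Arc K o d a ∧ z = e + c1 • (a - b) + c4 • (x - a))

lemma ineq0 {K : Set E} {o a b c d x : E} {k l : ℝ}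
    (h : Cfg K o a b c d k l) (hx : x ∈ Arc K o a b) (u : E →ₗ[ℝ] ℝ)
    (hu : ∀ z ∈ K, u z ≤ u x) {c1 c2 c3 c4 : ℝ} (h1 : 0 ≤ c1) (h2 : 0 ≤ c2) (h3 : 0 ≤ c3)
    (h4 : 0 ≤ c4)
    (hrel : c1 * (u b - u a) + c2 * (u c - u b) + c3 * (u d - u c) + c4 * (u a - u d) = 0) :
    (∀ y ∈ Arc K o a b, 0 ≤ c1 * (u x - u y)) ∧
    (∀ y ∈ Arc K o b c, 0 ≤ c1 * (u x - u b) + c2 * (u b - u y)) ∧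
    (∀ y ∈ Arc K o c d, 0 ≤ c1 * (u x - u b) + c2 * (u b - u c) + c3 * (u c - u y)) ∧
    (∀ y ∈ Arc K o d a, 0 ≤ c1 * (u x - u a) + c4 * (u a - u y)) := by
  refine ⟨fun y hy => ?_, fun y hy => ?_, fun y hy => ?_, fun y hy => ?_⟩
  · exact mul_nonneg h1 (sub_nonneg.2 (hu y hy.1.1))
  · exact fwd h hx hy u hu h1 h2 h3 h4 hrel
  · exact opp h hx hy u hu h1 h2 h3 h4 hrel
  · exact fwd h.refl (Arc.symm hx) (Arc.symm hy) u hu h1 h4 h3 h2 (by linarith)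

lemma ineq {K : Set E} {o a b c d x z : E} {k l : ℝ}
    (h : Cfg K o a b c d k l) {e : E} (u : E →ₗ[ℝ] ℝ)
    (hu : ∀ z ∈ K, u z ≤ u x) {c1 c2 c3 c4 : ℝ} (h1 : 0 ≤ c1) (h2 : 0 ≤ c2) (h3 : 0 ≤ c3)
    (h4 : 0 ≤ c4) (hrel : c1 • (b - a) + c2 • (c - b) + c3 • (d - c) + c4 • (a - d) = 0)
    (hxz : Rl K o a b c d c1 c2 c3 c4 e x z) (y w : E) (hyw : Rl K o a b c d c1 c2 c3 c4 e y w) :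
    u w ≤ u z := by
  have hr : c1 * (u b - u a) + c2 * (u c - u b) + c3 * (u d - u c) + c4 * (u a - u d) = 0 := by
    simpa using congrArg u hrel
  rcases hxz with ⟨hx, rfl⟩ | ⟨hx, rfl⟩ | ⟨hx, rfl⟩ | ⟨hx, rfl⟩
  · obtain ⟨g1, g2, g3, g4⟩ := ineq0 h hx u hu h1 h2 h3 h4 hr
    rcases hyw with ⟨hy, rfl⟩ | ⟨hy, rfl⟩ | ⟨hy, rfl⟩ | ⟨hy, rfl⟩ <;>
      simp only [map_add, map_smul, map_sub, smul_eq_mul]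
    · linarith [g1 y hy]
    · linarith [g2 y hy]
    · linarith [g3 y hy]
    · linarith [g4 y hy]
  · obtain ⟨g1, g2, g3, g4⟩ := ineq0 h.rot hx u hu h2 h3 h4 h1 (by linarith)
    rcases hyw with ⟨hy, rfl⟩ | ⟨hy, rfl⟩ | ⟨hy, rfl⟩ | ⟨hy, rfl⟩ <;>
      simp only [map_add, map_smul, map_sub, smul_eq_mul]
    · linarith [g4 y hy]
    · linarith [g1 y hy]
    · linarith [g2 y hy]
    · linarith [g3 y hy]
  · obtain ⟨g1, g2, g3, g4⟩ := ineq0 h.rot.rot hx u hu h3 h4 h1 h2 (by linarith)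
    rcases hyw with ⟨hy, rfl⟩ | ⟨hy, rfl⟩ | ⟨hy, rfl⟩ | ⟨hy, rfl⟩ <;>
      simp only [map_add, map_smul, map_sub, smul_eq_mul]
    · linarith [g3 y hy]
    · linarith [g4 y hy]
    · linarith [g1 y hy]
    · linarith [g2 y hy]
  · obtain ⟨g1, g2, g3, g4⟩ := ineq0 h.rot.rot.rot hx u hu h4 h1 h2 h3 (by linarith)
    rcases hyw with ⟨hy, rfl⟩ | ⟨hy, rfl⟩ | ⟨hy, rfl⟩ | ⟨hy, rfl⟩ <;>
      simp only [map_add, map_smul, map_sub, smul_eq_mul]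
    · linarith [g2 y hy]
    · linarith [g3 y hy]
    · linarith [g4 y hy]
    · linarith [g1 y hy]

lemma dec {K : Set E} {o a b c d x : E} {c1 c2 c3 c4 : ℝ}
    (hcov : x ∈ Arc K o a b ∨ x ∈ Arc K o b c ∨ x ∈ Arc K o c d ∨ x ∈ Arc K o d a) :
    ∃ p q, Rl K o a b c d c1 c2 c3 c4 0 x p ∧
      Rl K o a b c d (1 - c1) (1 - c2) (1 - c3) (1 - c4) b x q ∧ p + q = x := by
  rcases hcov with h | h | h | h
  · exact ⟨_, _, Or.inl ⟨h, rfl⟩, Or.inl ⟨h, rfl⟩, by module⟩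
  · exact ⟨_, _, Or.inr (Or.inl ⟨h, rfl⟩), Or.inr (Or.inl ⟨h, rfl⟩), by module⟩
  · exact ⟨_, _, Or.inr (Or.inr (Or.inl ⟨h, rfl⟩)), Or.inr (Or.inr (Or.inl ⟨h, rfl⟩)), by module⟩
  · exact ⟨_, _, Or.inr (Or.inr (Or.inr ⟨h, rfl⟩)), Or.inr (Or.inr (Or.inr ⟨h, rfl⟩)), by module⟩

/-- coefficients -/
lemma coeffs {K : Set E} {o a b c d : E} {k l : ℝ} (h : Cfg K o a b c d k l) :
    ∃ c1 c2 c3 c4 : ℝ, (0 ≤ c1 ∧ c1 ≤ 1) ∧ (0 ≤ c2 ∧ c2 ≤ 1) ∧ (0 ≤ c3 ∧ c3 ≤ 1) ∧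
      (0 ≤ c4 ∧ c4 ≤ 1) ∧ c1 ≠ c2 ∧
      c1 • (b - a) + c2 • (c - b) + c3 • (d - c) + c4 • (a - d) = 0 := by
  have hk := h.hk
  have hl := h.hl
  obtain ⟨r, hr, hr'⟩ : ∃ r : ℝ, 0 < r ∧ r * ((1 + k) * (1 + l)) = 1 / 4 :=
    ⟨1 / 4 / ((1 + k) * (1 + l)), by positivity, by field_simp⟩
  have hrk := mul_pos hr hk
  have hrl := mul_pos hr hl
  have hrkl := mul_pos hrk hl
  refine ⟨1 / 2, 1 / 2 + l * (1 + k) * r, 1 / 2 + (l * k - 1) * r, 1 / 2 + k * (1 + l) * r,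
    ?_, ?_, ?_, ?_, ?_, ?_⟩
  · norm_num
  · constructor <;> nlinarith
  · constructor <;> nlinarith
  · constructor <;> nlinarith
  · have : 0 < l * (1 + k) * r := by positivity
    linarith
  · rw [h.hac, h.hbd]
    module
end Gen2

section Top
variable {E : Type*} [NormedAddCommGroup E] [NormedSpace ℝ E] [FiniteDimensional ℝ E]

lemma hullBody {S : Set E} (hS : S.Nonempty) (hb : Bornology.IsBounded S) :
    IsConvexBody (closure (convexHull ℝ S)) :=
  ⟨hS.mono ((subset_convexHull ℝ S).trans subset_closure),
    Metric.isCompact_of_isClosed_isBounded isClosed_closure (isBounded_convexHull.2 hb).closure,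
    (convex_convexHull ℝ S).closure⟩

lemma hull_le {S : Set E} {u : E →L[ℝ] ℝ} {M : ℝ} (h : ∀ z ∈ S, u z ≤ M) :
    ∀ z ∈ closure (convexHull ℝ S), u z ≤ M := by
  have : closure (convexHull ℝ S) ⊆ {z | u z ≤ M} := by
    refine closure_minimal (convexHull_min h ?_) (isClosed_le u.continuous continuous_const)
    exact convex_halfSpace_le u.isLinear M
  exact this

lemma exists_ext_max {K : Set E} (hK : IsConvexBody K) (u : E →L[ℝ] ℝ) :
    ∃ x ∈ K.extremePoints ℝ, ∀ z ∈ K, u z ≤ u x := by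
  have hex : IsExposed ℝ K (u.toExposed K) := ContinuousLinearMap.toExposed.isExposed
  obtain ⟨m, hm, hmax⟩ := hK.2.1.exists_isMaxOn hK.1 u.continuous.continuousOn
  obtain ⟨x, hx⟩ := (hex.isCompact hK.2.1).extremePoints_nonempty ⟨m, hm, fun y hy => hmax hy⟩
  exact ⟨x, hex.isExtreme.extremePoints_subset_extremePoints hx, hx.1.2⟩

lemma sum_eq {K S T : Set E} (hK : IsConvexBody K) (hS : Bornology.IsBounded S)
    (hT : Bornology.IsBounded T)
    (h : ∀ x ∈ K.extremePoints ℝ, ∃ p ∈ S, ∃ q ∈ T, p + q = x ∧ ∀ u : E →L[ℝ] ℝ,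
      (∀ z ∈ K, u z ≤ u x) → (∀ z ∈ S, u z ≤ u p) ∧ (∀ z ∈ T, u z ≤ u q)) :
    IsConvexBody (closure (convexHull ℝ S)) ∧ IsConvexBody (closure (convexHull ℝ T)) ∧
    K = closure (convexHull ℝ S) + closure (convexHull ℝ T) := by
  obtain ⟨x0, hx0⟩ := hK.2.1.extremePoints_nonempty hK.1
  obtain ⟨p0, hp0, q0, hq0, -⟩ := h x0 hx0
  have b1 := hullBody ⟨p0, hp0⟩ hS
  have b2 := hullBody ⟨q0, hq0⟩ hT
  refine ⟨b1, b2, subset_antisymm ?_ ?_⟩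
  · rw [← closure_convexHull_extremePoints hK.2.1 hK.2.2]
    refine closure_minimal (convexHull_min ?_ (b1.2.2.add b2.2.2)) (b1.2.1.add b2.2.1).isClosed
    intro x hx
    obtain ⟨p, hp, q, hq, e, -⟩ := h x hx
    exact ⟨p, subset_closure (subset_convexHull ℝ S hp), q,
      subset_closure (subset_convexHull ℝ T hq), e⟩
  · rintro w ⟨p, hp, q, hq, rfl⟩
    by_contra hw
    obtain ⟨u, r, h1, h2⟩ := geometric_hahn_banach_closed_point hK.2.2 hK.2.1.isClosed hw
    obtain ⟨x, hx, hmax⟩ := exists_ext_max hK u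
    obtain ⟨p', hp', q', hq', e, h3⟩ := h x hx
    obtain ⟨h4, h5⟩ := h3 u hmax
    have h6 := hull_le h4 p hp
    have h7 := hull_le h5 q hq
    have h8 := h1 x hx.1
    rw [← e] at h8
    simp only [map_add] at h2 h8
    linarith

lemma ext_homothetic {K K' K'' : Set E} (hK : IsConvexBody K) (hK'' : IsConvexBody K'')
    (hnt : K.Nontrivial) (hsum : K = K' + K'') {l : ℝ} {t : E} (hl : 0 ≤ l)
    (hK' : K' = l • K + {t}) {x p q : E} (hx : x ∈ K.extremePoints ℝ) (hp : p ∈ K') (hq : q ∈ K'')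
    (hpq : p + q = x) : p = l • x + t := by
  have hmem : ∀ z ∈ K, l • z + t ∈ K' := fun z hz => by
    rw [hK']
    exact Set.add_mem_add (Set.smul_mem_smul_set hz) rfl
  have hl1 : l ≤ 1 := by
    have hd : 0 < Metric.diam K := Metric.diam_pos hnt hK.2.1.isBounded
    have hsub : l • K ⊆ (fun z => z - (t + q)) '' K := by
      rintro _ ⟨z, hz, rfl⟩
      refine ⟨l • z + t + q, ?_, by simp only []; abel⟩
      rw [hsum]
      exact Set.add_mem_add (hmem z hz) hq
    have hiso : Isometry (fun z : E => z - (t + q)) := Isometry.of_dist_eq fun z w => dist_sub_right z w _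
    have := Metric.diam_mono hsub (hiso.lipschitz.isBounded_image hK.2.1.isBounded)
    rw [diam_smul₀, hiso.diam_image, Real.norm_of_nonneg hl] at this
    nlinarith
  have hs : (1 - l) • x - t ∈ K'' := by
    by_contra hw
    obtain ⟨u, r, h1, h2⟩ := geometric_hahn_banach_closed_point hK''.2.2 hK''.2.1.isClosed hw
    obtain ⟨m, hm, hmax⟩ := hK.2.1.exists_isMaxOn hK.1 u.continuous.continuousOn
    have hm' := hm
    rw [hsum] at hm'
    obtain ⟨p1, hp1, s, hs, e⟩ := hm'
    rw [hK'] at hp1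
    obtain ⟨_, ⟨k, hk, rfl⟩, t', ht', e2⟩ := hp1
    rw [Set.mem_singleton_iff] at ht'
    subst ht'
    have g1 : u k ≤ u m := hmax hk
    have g2 : u x ≤ u m := hmax hx.1
    have g3 := h1 s hs
    have g4 : u m = l * u k + u t' + u s := by
      rw [← e, ← e2]; simp
    simp only [map_sub, map_smul, smul_eq_mul] at h2
    nlinarith
  have e1 : (l • x + t) + q ∈ K := by rw [hsum]; exact Set.add_mem_add (hmem x hx.1) hq
  have e2 : p + ((1 - l) • x - t) ∈ K := by rw [hsum]; exact Set.add_mem_add hp hs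
  have := (ext_of_open hx e1 e2 (w := 1 / 2) (by norm_num) (by norm_num) (by
    have : x = (1 / 2 : ℝ) • x + (1 / 2 : ℝ) • (p + q) := by rw [hpq]; module
    nth_rw 1 [this]; module)).1
  have h3 : l • x + t + q = p + q := by rw [this, hpq]
  exact (add_right_cancel h3).symm
end Top
section Tri
variable {E : Type*} [AddCommGroup E] [Module ℝ E]

lemma tri_mem {x y z p : E} : p ∈ convexHull ℝ {x, y, z} ↔
    ∃ s t : ℝ, 0 ≤ s ∧ 0 ≤ t ∧ s + t ≤ 1 ∧ p = x + s • (y - x) + t • (z - x) := by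
  constructor
  · intro h
    rw [convexHull_insert (Set.insert_nonempty _ _), convexHull_pair, mem_convexJoin] at h
    obtain ⟨x', hx, w, ⟨c, d, hc, hd, hcd, rfl⟩, a, b, ha, hb, hab, rfl⟩ := h
    rw [Set.mem_singleton_iff] at hx
    subst hx
    refine ⟨b * c, b * d, by positivity, by positivity, ?_, ?_⟩
    · rw [← mul_add, hcd]; linarith
    · obtain rfl : a = 1 - b := by linarith
      obtain rfl : c = 1 - d := by linarith
      module
  · rintro ⟨s, t, hs, ht, hst, rfl⟩
    have hC := convex_convexHull ℝ ({x, y, z} : Set E)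
    have hx : x ∈ convexHull ℝ ({x, y, z} : Set E) := subset_convexHull _ _ (by simp)
    have hy : y ∈ convexHull ℝ ({x, y, z} : Set E) := subset_convexHull _ _ (by simp)
    have hz : z ∈ convexHull ℝ ({x, y, z} : Set E) := subset_convexHull _ _ (by simp)
    rcases eq_or_lt_of_le (add_nonneg hs ht) with h0 | h0
    · have hv0 : s = 0 := by linarith
      have hw0 : t = 0 := by linarith
      subst hv0 hw0
      simpa using hx
    · have hm := hC hy hz (a := s / (s + t)) (b := t / (s + t)) (by positivity) (by positivity)
        (by field_simp)
      have := hC hx hm (a := 1 - (s + t)) (b := s + t) (by linarith) h0.le (by ring)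
      convert this using 1
      match_scalars <;> field_simp
      ring

lemma seg_mem {x y p : E} : p ∈ segment ℝ x y ↔
    ∃ s : ℝ, 0 ≤ s ∧ s ≤ 1 ∧ p = x + s • (y - x) := by
  constructor
  · rintro ⟨a, b, ha, hb, hab, rfl⟩
    refine ⟨b, hb, by linarith, ?_⟩
    obtain rfl : a = 1 - b := by linarith
    module
  · rintro ⟨s, h0, h1, rfl⟩
    exact ⟨1 - s, s, by linarith, h0, by ring, by module⟩

lemma homothetic_of {K K' : Set E} {a : ℝ} {x x' : E} (ha : 0 ≤ a)
    (h1 : ∀ k ∈ K, x' + a • (k - x) ∈ K')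
    (h2 : ∀ p ∈ K', ∃ k ∈ K, p = x' + a • (k - x)) : HomotheticTo K' K := by
  refine ⟨a, x' - a • x, ha, ?_⟩
  ext p
  constructor
  · intro hp
    obtain ⟨k, hk, rfl⟩ := h2 p hp
    exact ⟨a • k, Set.smul_mem_smul_set hk, x' - a • x, rfl, by module⟩
  · rintro ⟨_, ⟨k, hk, rfl⟩, t, ht, rfl⟩
    rw [Set.mem_singleton_iff] at ht
    subst ht
    convert h1 k hk using 1
    module

lemma seg_hom {x y : E} {K' K'' : Set E} (hc : Convex ℝ K')
    (h : segment ℝ x y = K' + K'') : HomotheticTo K' (segment ℝ x y) := by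
  have hx : x ∈ K' + K'' := h ▸ left_mem_segment ℝ x y
  have hy : y ∈ K' + K'' := h ▸ right_mem_segment ℝ x y
  obtain ⟨x', hx', x'', hx'', ex⟩ := hx
  obtain ⟨y', hy', y'', hy'', ey⟩ := hy
  simp only [] at ex ey
  have f1 : ∀ p ∈ K', ∃ s : ℝ, 0 ≤ s ∧ p = x' + s • (y - x) := fun p hp => by
    have : p + x'' ∈ segment ℝ x y := h ▸ Set.add_mem_add hp hx''
    obtain ⟨s, h0, h1, e⟩ := seg_mem.1 this
    refine ⟨s, h0, ?_⟩
    have e' : p = x - x'' + s • (y - x) := by rw [sub_add_eq_add_sub, ← e]; abel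
    rw [e', ← ex]; module
  have f2 : ∀ p ∈ K', ∃ s : ℝ, s ≤ 1 ∧ p = y' + (s - 1) • (y - x) := fun p hp => by
    have : p + y'' ∈ segment ℝ x y := h ▸ Set.add_mem_add hp hy''
    obtain ⟨s, h0, h1, e⟩ := seg_mem.1 this
    refine ⟨s, h1, ?_⟩
    have e' : p = x + s • (y - x) - y'' := by rw [← e]; abel
    have e'' : y' = y - y'' := by rw [← ey]; abel
    rw [e', e'']; module
  obtain ⟨a, ha, ea⟩ := f1 y' hy'
  refine homothetic_of (a := a) (x := x) (x' := x') ha ?_ ?_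
  · intro k hk
    obtain ⟨s, h0, h1, rfl⟩ := seg_mem.1 hk
    have : x' + s • (y' - x') ∈ segment ℝ x' y' := seg_mem.2 ⟨s, h0, h1, rfl⟩
    have := hc.segment_subset hx' hy' this
    convert this using 1
    rw [ea]; module
  · intro p hp
    obtain ⟨s, hs, e1⟩ := f1 p hp
    obtain ⟨r, hr, e2⟩ := f2 p hp
    by_cases hu : y - x = 0
    · exact ⟨x, left_mem_segment ℝ x y, by rw [e1, hu]; simp⟩
    · have e3 : (s - (a + (r - 1))) • (y - x) = 0 := by
        have : x' + s • (y - x) = x' + a • (y - x) + (r - 1) • (y - x) := by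
          rw [← e1, ← ea, ← e2]
        have h4 := sub_eq_zero.2 this
        rw [← h4]; module
      have h4 : s - (a + (r - 1)) = 0 := by simpa [hu] using e3
      have hsa : s ≤ a := by linarith
      rcases eq_or_lt_of_le ha with h0 | h0
      · have : s = 0 := by linarith
        exact ⟨x, left_mem_segment ℝ x y, by rw [e1, this]; simp⟩
      · refine ⟨x + (s / a) • (y - x), seg_mem.2 ⟨s / a, by positivity, ?_, rfl⟩, ?_⟩
        · rw [div_le_one h0]; exact hsa
        · rw [e1]
          match_scalars <;> field_simp <;> ring

lemma tri_hom {x y z : E} {K K' K'' : Set E} (hK : K = convexHull ℝ {x, y, z}) (hc : Convex ℝ K')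
    (hli : ∀ s t : ℝ, s • (y - x) + t • (z - x) = 0 → s = 0 ∧ t = 0)
    (h : K = K' + K'') : HomotheticTo K' K := by
  have hx : x ∈ K' + K'' := by rw [← h, hK]; exact subset_convexHull _ _ (by simp)
  have hy : y ∈ K' + K'' := by rw [← h, hK]; exact subset_convexHull _ _ (by simp)
  have hz : z ∈ K' + K'' := by rw [← h, hK]; exact subset_convexHull _ _ (by simp)
  obtain ⟨x', hx', x'', hx'', ex⟩ := hx
  obtain ⟨y', hy', y'', hy'', ey⟩ := hy
  obtain ⟨z', hz', z'', hz'', ez⟩ := hz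
  simp only [] at ex ey ez
  have key : ∀ p ∈ K', ∀ q ∈ K'', ∃ s t : ℝ, 0 ≤ s ∧ 0 ≤ t ∧ s + t ≤ 1 ∧
      p = x + s • (y - x) + t • (z - x) - q := fun p hp q hq => by
    have : p + q ∈ K := h ▸ Set.add_mem_add hp hq
    rw [hK] at this
    obtain ⟨s, t, hs, ht, hst, e⟩ := tri_mem.1 this
    exact ⟨s, t, hs, ht, hst, by rw [← e]; abel⟩
  have ex2 : x'' = x - x' := by rw [← ex]; abel
  have ey2 : y'' = y - y' := by rw [← ey]; abel
  have ez2 : z'' = z - z' := by rw [← ez]; abel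
  have f1 : ∀ p ∈ K', ∃ s t : ℝ, 0 ≤ s ∧ 0 ≤ t ∧
      p = x' + s • (y - x) + t • (z - x) := fun p hp => by
    obtain ⟨s, t, hs, ht, hst, e⟩ := key p hp x'' hx''
    exact ⟨s, t, hs, ht, by rw [e, ex2]; module⟩
  obtain ⟨a, b, ha, hb, eay⟩ := f1 y' hy'
  obtain ⟨c, e, hcn, he, eaz⟩ := f1 z' hz'
  have uniq : ∀ s t s' t' : ℝ, x' + s • (y - x) + t • (z - x) = x' + s' • (y - x) + t' • (z - x) →
      s = s' ∧ t = t' := by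
    intro s t s' t' hh
    have h4 := sub_eq_zero.2 hh
    have := hli (s - s') (t - t') (by rw [← h4]; module)
    constructor <;> linarith
  have f2 : ∀ s t : ℝ, x' + s • (y - x) + t • (z - x) ∈ K' → s + t ≤ a + b ∧ b ≤ t := by
    intro s t hp
    obtain ⟨s1, t1, hs1, ht1, hst1, e1⟩ := key _ hp y'' hy''
    rw [ey2, eay] at e1
    have := uniq s t (a + (s1 - 1)) (b + t1) (by rw [e1]; module)
    constructor <;> linarith
  have f3 : ∀ s t : ℝ, x' + s • (y - x) + t • (z - x) ∈ K' → s + t ≤ c + e ∧ c ≤ s := by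
    intro s t hp
    obtain ⟨s1, t1, hs1, ht1, hst1, e1⟩ := key _ hp z'' hz''
    rw [ez2, eaz] at e1
    have := uniq s t (c + s1) (e + (t1 - 1)) (by rw [e1]; module)
    constructor <;> linarith
  have hx0 : x' + (0 : ℝ) • (y - x) + (0 : ℝ) • (z - x) ∈ K' := by simpa using hx'
  have hb0 : b = 0 := le_antisymm (f2 0 0 hx0).2 hb
  have hc0 : c = 0 := le_antisymm (f3 0 0 hx0).2 hcn
  have hae : e = a := by
    have g1 := (f2 c e (eaz ▸ hz')).1
    have g2 := (f3 a b (eay ▸ hy')).1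
    linarith
  subst hb0 hc0 hae
  refine homothetic_of (a := e) (x := x) (x' := x') ha ?_ ?_
  · intro k hk
    rw [hK] at hk
    obtain ⟨s, t, hs, ht, hst, rfl⟩ := tri_mem.1 hk
    have : x' + s • (y' - x') + t • (z' - x') ∈ convexHull ℝ {x', y', z'} :=
      tri_mem.2 ⟨s, t, hs, ht, hst, rfl⟩
    have := convexHull_min (t := K') (by
      rintro p (rfl | rfl | rfl) <;> assumption) hc this
    convert this using 1
    rw [eay, eaz]; module
  · intro p hp
    obtain ⟨s, t, hs, ht, e1⟩ := f1 p hp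
    have g := (f2 s t (e1 ▸ hp)).1
    rcases eq_or_lt_of_le ha with h0 | h0
    · have hs0 : s = 0 := by linarith
      have ht0 : t = 0 := by linarith
      exact ⟨x, by rw [hK]; exact subset_convexHull _ _ (by simp), by rw [e1, hs0, ht0]; simp⟩
    · refine ⟨x + (s / e) • (y - x) + (t / e) • (z - x), ?_, ?_⟩
      · rw [hK]
        refine tri_mem.2 ⟨s / e, t / e, by positivity, by positivity, ?_, rfl⟩
        rw [← add_div, div_le_one h0]; linarith
      · rw [e1]
        match_scalars <;> field_simp <;> ring

lemma seg_of_between {x y z : E} (h : y ∈ segment ℝ x z) :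
    convexHull ℝ {x, y, z} = segment ℝ x z := by
  apply subset_antisymm
  · refine convexHull_min ?_ (convex_segment x z)
    rintro p (rfl | rfl | rfl)
    · exact left_mem_segment ℝ _ _
    · exact h
    · exact right_mem_segment ℝ _ _
  · exact segment_subset_convexHull (by simp) (by simp)

lemma tri_indec [TopologicalSpace E] (x y z : E) : Indecomposable (convexHull ℝ {x, y, z}) := by
  intro K' K'' h1 h2 hs
  left
  by_cases hli : ∀ s t : ℝ, s • (y - x) + t • (z - x) = 0 → s = 0 ∧ t = 0
  · exact tri_hom rfl h1.2.2 hli hs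
  · have hcol : Collinear ℝ {x, y, z} := by
      push Not at hli
      obtain ⟨s, t, e, hst⟩ := hli
      rw [collinear_iff_of_mem (p₀ := x) (by simp)]
      by_cases ht : t = 0
      · refine ⟨z - x, ?_⟩
        rintro p (rfl | rfl | rfl)
        · exact ⟨0, by simp⟩
        · refine ⟨0, ?_⟩
          have : p - x = 0 := by
            rw [ht, zero_smul, add_zero] at e
            exact (smul_eq_zero.1 e).resolve_left (fun h => hst h ht)
          simp [sub_eq_zero.1 this]
        · exact ⟨1, by simp⟩
      · refine ⟨y - x, ?_⟩
        rintro p (rfl | rfl | rfl)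
        · exact ⟨0, by simp⟩
        · exact ⟨1, by simp⟩
        · refine ⟨-s / t, ?_⟩
          have : p - x = (-s / t) • (y - x) := by
            have h5 : (1 / t) • (s • (y - x) + t • (p - x)) = 0 := by rw [e, smul_zero]
            rw [← sub_eq_zero, ← h5]
            match_scalars <;> field_simp
            ring
          rw [← this]; simp
    rcases hcol.wbtw_or_wbtw_or_wbtw with w | w | w
    · have := seg_of_between (mem_segment_iff_wbtw.2 w)
      rw [this] at hs ⊢
      exact seg_hom h1.2.2 hs
    · have := seg_of_between (mem_segment_iff_wbtw.2 w)
      rw [show ({x, y, z} : Set E) = {y, z, x} by ext; simp; tauto, this] at hs ⊢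
      exact seg_hom h1.2.2 hs
    · have := seg_of_between (mem_segment_iff_wbtw.2 w)
      rw [show ({x, y, z} : Set E) = {z, x, y} by ext; simp; tauto, this] at hs ⊢
      exact seg_hom h1.2.2 hs
end Tri
section Plane
variable {K : Set (Fin 2 → ℝ)} {o a b c d x : Fin 2 → ℝ} {k l : ℝ}

lemma no_ray (ho : o ∈ K) (ho' : o ∉ K.extremePoints ℝ) (ha : a ∈ K.extremePoints ℝ)
    (hb : b ∈ K.extremePoints ℝ) (hab : a ≠ b) {v : ℝ} (hv : 0 < v) (h : b = o + v • (a - o)) :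
    False := by
  rcases lt_trichotomy v 1 with h1 | h1 | h1
  · apply ho'
    rw [(ext_of_open hb ha.1 ho hv h1 (by rw [h]; module)).2]; exact hb
  · subst h1
    apply hab; rw [h]; module
  · apply ho'
    rw [(ext_of_open ha hb.1 ho (w := 1 / v) (by positivity) (by rw [div_lt_one hv]; exact h1) (by
      rw [h]
      match_scalars <;> field_simp <;> ring)).2]; exact ha

lemma cover (h : Cfg K o a b c d k l) (hab : a ≠ b) (hbc : b ≠ c) (hx : x ∈ K.extremePoints ℝ) :
    x ∈ Arc K o a b ∨ x ∈ Arc K o b c ∨ x ∈ Arc K o c d ∨ x ∈ Arc K o d a := by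
  have hk := h.hk
  have hl := h.hl
  have hao : a ≠ o := fun e => h.ho' (e ▸ h.ha)
  have hbo : b ≠ o := fun e => h.ho' (e ▸ h.hb)
  obtain ⟨s, t, e⟩ : ∃ s t : ℝ, x = o + s • (a - o) + t • (b - o) := by
    by_cases hD : (a 0 - o 0) * (b 1 - o 1) - (a 1 - o 1) * (b 0 - o 0) = 0
    · exfalso
      obtain ⟨v, hv⟩ : ∃ v : ℝ, b = o + v • (a - o) := by
        by_cases h0 : a 0 - o 0 = 0
        · have h1 : a 1 - o 1 ≠ 0 := by
            intro h1
            apply hao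
            ext i; fin_cases i
            · exact sub_eq_zero.1 h0
            · exact sub_eq_zero.1 h1
          refine ⟨(b 1 - o 1) / (a 1 - o 1), ?_⟩
          have h2 : b 0 - o 0 = 0 := by
            rw [h0, zero_mul, zero_sub, neg_eq_zero] at hD
            exact (mul_eq_zero.1 hD).resolve_left h1
          ext i; fin_cases i
          · simp [h0]; linarith
          · simp; field_simp; ring
        · refine ⟨(b 0 - o 0) / (a 0 - o 0), ?_⟩
          ext i; fin_cases i
          · simp; field_simp; ring
          · simp; field_simp; linarith
      rcases lt_trichotomy v 0 with h1 | h1 | h1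
      · refine no_ray h.ho h.ho' h.hc h.hb hbc.symm (v := -v / k)
          (div_pos (by linarith) hk) ?_
        rw [hv, h.hac]
        match_scalars <;> field_simp <;> ring
      · apply hbo; rw [hv, h1]; simp
      · exact no_ray h.ho h.ho' h.ha h.hb hab h1 hv
    · set D := (a 0 - o 0) * (b 1 - o 1) - (a 1 - o 1) * (b 0 - o 0) with hDD
      refine ⟨((x 0 - o 0) * (b 1 - o 1) - (x 1 - o 1) * (b 0 - o 0)) / D,
        ((a 0 - o 0) * (x 1 - o 1) - (a 1 - o 1) * (x 0 - o 0)) / D, ?_⟩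
      ext i; fin_cases i
      · simp; field_simp; rw [hDD]; ring
      · simp; field_simp; rw [hDD]; ring
  rcases le_or_gt 0 s with hs | hs <;> rcases le_or_gt 0 t with ht | ht
  · exact Or.inl ⟨hx, s, t, hs, ht, e⟩
  · refine Or.inr (Or.inr (Or.inr ⟨hx, -t / l, s, (div_pos (by linarith) hl).le, hs, ?_⟩))
    rw [e, h.hbd]
    match_scalars <;> field_simp <;> ring
  · refine Or.inr (Or.inl ⟨hx, t, -s / k, ht, (div_pos (by linarith) hk).le, ?_⟩)
    rw [e, h.hac]
    match_scalars <;> field_simp <;> ring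
  · refine Or.inr (Or.inr (Or.inl ⟨hx, -s / k, -t / l, (div_pos (by linarith) hk).le,
      (div_pos (by linarith) hl).le, ?_⟩))
    rw [e, h.hac, h.hbd]
    match_scalars <;> field_simp <;> ring

lemma cfg_of_cross (hK : Convex ℝ K) (ha : a ∈ K.extremePoints ℝ) (hb : b ∈ K.extremePoints ℝ)
    (hc : c ∈ K.extremePoints ℝ) (hd : d ∈ K.extremePoints ℝ)
    (hab : a ≠ b) (hac : a ≠ c) (had : a ≠ d) (hbc : b ≠ c) (hbd : b ≠ d) (hcd : c ≠ d)
    (h1 : o ∈ segment ℝ a c) (h2 : o ∈ segment ℝ b d) :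
    ∃ k l, Cfg K o a b c d k l := by
  have ho : o ∈ K := hK.segment_subset ha.1 hc.1 h1
  have key : ∀ p q : Fin 2 → ℝ, p ∈ K.extremePoints ℝ → q ∈ K.extremePoints ℝ → p ≠ q →
      o ∈ segment ℝ p q → o ∈ K.extremePoints ℝ → o = p ∨ o = q := by
    intro p q hp hq hpq hs he
    rcases (mem_extremePoints_iff_left.1 he) with ⟨-, h⟩
    by_contra hne
    push Not at hne
    have := mem_openSegment_of_ne_left_right hne.1.symm hne.2.symm hs
    exact hne.1 (h p hp.1 q hq.1 this).symm
  have ho' : o ∉ K.extremePoints ℝ := by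
    intro he
    rcases key a c ha hc hac h1 he with e | e <;> rcases key b d hb hd hbd h2 he with e' | e' <;>
      rw [e] at e' <;> first | exact hab e' | exact had e' | exact hbc e'.symm | exact hcd e'
  have key2 : ∀ p q : Fin 2 → ℝ, p ∈ K.extremePoints ℝ → q ∈ K.extremePoints ℝ →
      o ∈ segment ℝ p q → ∃ k : ℝ, 0 < k ∧ q = o - k • (p - o) := by
    rintro p q hp hq ⟨v, w, hv, hw, hvw, e⟩
    have hw0 : w ≠ 0 := by
      rintro rfl
      obtain rfl : v = 1 := by linarith
      apply ho'; rw [← e]; simpa using hp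
    have hv0 : v ≠ 0 := by
      rintro rfl
      obtain rfl : w = 1 := by linarith
      apply ho'; rw [← e]; simpa using hq
    have hv1 : 0 < v := lt_of_le_of_ne hv hv0.symm
    have hw1 : 0 < w := lt_of_le_of_ne hw hw0.symm
    refine ⟨v / w, by positivity, ?_⟩
    rw [← e]
    obtain rfl : v = 1 - w := by linarith
    match_scalars <;> field_simp <;> ring
  obtain ⟨k, hk, ek⟩ := key2 a c ha hc h1
  obtain ⟨l, hl, el⟩ := key2 b d hb hd h2
  exact ⟨k, l, hK, ha, hb, hc, hd, ho, ho', hk, hl, ek, el⟩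

lemma ext_not_hull {p : Fin 2 → ℝ} {S : Set (Fin 2 → ℝ)} (hK : Convex ℝ K)
    (hp : p ∈ K.extremePoints ℝ) (hS : S ⊆ K) (h : p ∈ convexHull ℝ S) : p ∈ S :=
  extremePoints_convexHull_subset
    (inter_extremePoints_subset_extremePoints_of_subset (convexHull_min hS hK) ⟨h, hp⟩)

lemma exists_cfg (hK : Convex ℝ K) (f : Fin 4 → Fin 2 → ℝ) (hf : ∀ i, f i ∈ K.extremePoints ℝ)
    (hinj : Function.Injective f) :
    ∃ o a b c d k l, Cfg K o a b c d k l ∧ a ≠ b ∧ b ≠ c := by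
  have hna : ¬ AffineIndependent ℝ f := by
    intro h
    have h1 := h.card_le_finrank_succ
    have h2 := Submodule.finrank_le (vectorSpan ℝ (Set.range f))
    simp at h1 h2
    omega
  obtain ⟨I, o, h1, h2⟩ := Convex.radon_partition hna
  have hne : ∀ i j, i ≠ j → f i ≠ f j := fun i j h e => h (hinj e)
  -- no index set of size one
  have hsing : ∀ J : Set (Fin 4), o ∈ convexHull ℝ (f '' J) → o ∈ convexHull ℝ (f '' Jᶜ) →
      ∀ i, J ≠ {i} := by
    rintro J h1 h2 i rfl
    rw [Set.image_singleton, convexHull_singleton, Set.mem_singleton_iff] at h1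
    subst h1
    obtain ⟨j, hj, e⟩ := ext_not_hull hK (hf i) (by rintro _ ⟨j, -, rfl⟩; exact (hf j).1) h2
    exact hj (hinj e)
  have hemp : ∀ J : Set (Fin 4), o ∈ convexHull ℝ (f '' J) → J ≠ ∅ := by
    rintro J h1 rfl
    simp at h1
  have pair : ∀ i j p q : Fin 4, i ≠ j → i ≠ p → i ≠ q → j ≠ p → j ≠ q → p ≠ q →
      ∀ J : Set (Fin 4), J = {i, j} → Jᶜ = {p, q} → 
      o ∈ convexHull ℝ (f '' J) → o ∈ convexHull ℝ (f '' Jᶜ) →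
      ∃ o a b c d k l, Cfg K o a b c d k l ∧ a ≠ b ∧ b ≠ c := by
    intro i j p q hij hip hiq hjp hjq hpq J hJ hJc h1 h2
    rw [hJ, Set.image_pair, convexHull_pair] at h1
    rw [hJc, Set.image_pair, convexHull_pair] at h2
    obtain ⟨k, l, h⟩ := cfg_of_cross hK (hf i) (hf p) (hf j) (hf q) (hne _ _ hip) (hne _ _ hij)
      (hne _ _ hiq) (hne _ _ hjp).symm (hne _ _ hpq) (hne _ _ hjq) h1 h2
    exact ⟨o, f i, f p, f j, f q, k, l, h, hne _ _ hip, (hne _ _ hjp).symm⟩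
  have main : ∀ J : Set (Fin 4), (0 : Fin 4) ∈ J → 
      o ∈ convexHull ℝ (f '' J) → o ∈ convexHull ℝ (f '' Jᶜ) →
      ∃ o a b c d k l, Cfg K o a b c d k l ∧ a ≠ b ∧ b ≠ c := by
    intro J h0 h1 h2
    have hs1 := hsing J h1 h2
    have hs2 := hsing Jᶜ h2 (by rwa [compl_compl])
    have he := hemp Jᶜ h2
    by_cases m1 : (1 : Fin 4) ∈ J <;> by_cases m2 : (2 : Fin 4) ∈ J <;>
      by_cases m3 : (3 : Fin 4) ∈ J
    · exact absurd (by ext i; fin_cases i <;> simp [*]) he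
    · exact absurd (by ext i; fin_cases i <;> simp [*]) (hs2 3)
    · exact absurd (by ext i; fin_cases i <;> simp [*]) (hs2 2)
    · exact pair 0 1 2 3 (by decide) (by decide) (by decide) (by decide) (by decide) (by decide) J
        (by ext i; fin_cases i <;> simp [*]) (by ext i; fin_cases i <;> simp [*]) h1 h2
    · exact absurd (by ext i; fin_cases i <;> simp [*]) (hs2 1)
    · exact pair 0 2 1 3 (by decide) (by decide) (by decide) (by decide) (by decide) (by decide) J
        (by ext i; fin_cases i <;> simp [*]) (by ext i; fin_cases i <;> simp [*]) h1 h2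
    · exact pair 0 3 1 2 (by decide) (by decide) (by decide) (by decide) (by decide) (by decide) J
        (by ext i; fin_cases i <;> simp [*]) (by ext i; fin_cases i <;> simp [*]) h1 h2
    · exact absurd (by ext i; fin_cases i <;> simp [*]) (hs1 0)
  by_cases h0 : (0 : Fin 4) ∈ I
  · exact main I h0 h1 h2
  · exact main Iᶜ h0 h2 (by rwa [compl_compl])

lemma Rl_bounded (hK : IsConvexBody K) (c1 c2 c3 c4 : ℝ) (e : Fin 2 → ℝ) :
    Bornology.IsBounded {z | ∃ x, Rl K o a b c d c1 c2 c3 c4 e x z} := by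
  have hb : ∀ g : (Fin 2 → ℝ) → (Fin 2 → ℝ), Continuous g → Bornology.IsBounded (g '' K) :=
    fun g hg => (hK.2.1.image hg).isBounded
  refine Bornology.IsBounded.subset
    ((((hb (fun x => e + c1 • (x - b)) (by fun_prop)).union
      (hb (fun x => e + c2 • (x - b)) (by fun_prop))).union
      (hb (fun x => e + c2 • (c - b) + c3 • (x - c)) (by fun_prop))).union
      (hb (fun x => e + c1 • (a - b) + c4 • (x - a)) (by fun_prop))) ?_
  rintro z ⟨x, ⟨hx, rfl⟩ | ⟨hx, rfl⟩ | ⟨hx, rfl⟩ | ⟨hx, rfl⟩⟩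
  · exact Or.inl (Or.inl (Or.inl ⟨x, hx.1.1, rfl⟩))
  · exact Or.inl (Or.inl (Or.inr ⟨x, hx.1.1, rfl⟩))
  · exact Or.inl (Or.inr ⟨x, hx.1.1, rfl⟩)
  · exact Or.inr ⟨x, hx.1.1, rfl⟩

lemma four_dec (hK : IsConvexBody K) (h : Cfg K o a b c d k l) (hab : a ≠ b) (hbc : b ≠ c) :
    ¬ Indecomposable K := by
  intro hind
  obtain ⟨c1, c2, c3, c4, h1, h2, h3, h4, hne, hrel⟩ := coeffs h
  have hrel2 : (1 - c1) • (b - a) + (1 - c2) • (c - b) + (1 - c3) • (d - c) + (1 - c4) • (a - d)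
      = 0 := by
    have : (1 - c1) • (b - a) + (1 - c2) • (c - b) + (1 - c3) • (d - c) + (1 - c4) • (a - d)
      = -(c1 • (b - a) + c2 • (c - b) + c3 • (d - c) + c4 • (a - d)) := by module
    rw [this, hrel, neg_zero]
  set S := {z | ∃ x, Rl K o a b c d c1 c2 c3 c4 0 x z} with hS
  set T := {z | ∃ x, Rl K o a b c d (1 - c1) (1 - c2) (1 - c3) (1 - c4) b x z} with hT
  obtain ⟨b1, b2, hsum⟩ := sum_eq (S := S) (T := T) hK (Rl_bounded hK _ _ _ _ _)
    (Rl_bounded hK _ _ _ _ _) (by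
    intro x hx
    obtain ⟨p, q, hp, hq, e⟩ := dec (c1 := c1) (c2 := c2) (c3 := c3) (c4 := c4)
      (cover h hab hbc hx)
    refine ⟨p, ⟨x, hp⟩, q, ⟨x, hq⟩, e, fun u hu => ⟨?_, ?_⟩⟩
    · rintro z ⟨y, hy⟩
      exact ineq h u.toLinearMap hu h1.1 h2.1 h3.1 h4.1 hrel hp y z hy
    · rintro z ⟨y, hy⟩
      exact ineq h u.toLinearMap hu (sub_nonneg.2 h1.2) (sub_nonneg.2 h2.2) (sub_nonneg.2 h3.2)
        (sub_nonneg.2 h4.2) hrel2 hq y z hy)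
  have hnt : K.Nontrivial := ⟨a, h.ha.1, b, h.hb.1, hab⟩
  have inc : ∀ {S : Set (Fin 2 → ℝ)} {z}, z ∈ S → z ∈ closure (convexHull ℝ S) :=
    fun hz => subset_closure (subset_convexHull ℝ _ hz)
  have aA : a ∈ Arc K o a b := ⟨h.ha, 1, 0, by norm_num, le_rfl, by module⟩
  have bA : b ∈ Arc K o a b := ⟨h.hb, 0, 1, le_rfl, by norm_num, by module⟩
  have cA : c ∈ Arc K o b c := ⟨h.hc, 0, 1, le_rfl, by norm_num, by module⟩
  have Sa : 0 + c1 • (a - b) ∈ S := ⟨a, Or.inl ⟨aA, rfl⟩⟩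
  have Sb : 0 + c1 • (b - b) ∈ S := ⟨b, Or.inl ⟨bA, rfl⟩⟩
  have Sc : 0 + c2 • (c - b) ∈ S := ⟨c, Or.inr (Or.inl ⟨cA, rfl⟩)⟩
  have Ta : b + (1 - c1) • (a - b) ∈ T := ⟨a, Or.inl ⟨aA, rfl⟩⟩
  have Tb : b + (1 - c1) • (b - b) ∈ T := ⟨b, Or.inl ⟨bA, rfl⟩⟩
  have Tc : b + (1 - c2) • (c - b) ∈ T := ⟨c, Or.inr (Or.inl ⟨cA, rfl⟩)⟩
  have fin : ∀ (v w m : ℝ) (e t : Fin 2 → ℝ), e + v • (a - b) = m • a + t →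
      e + v • (b - b) = m • b + t → e + w • (c - b) = m • c + t → v = w := by
    intro v w m e t g1 g2 g3
    have k1 : (v - m) • (a - b) = 0 := by
      have : (v - m) • (a - b) = (e + v • (a - b)) - (e + v • (b - b)) - m • (a - b) := by module
      rw [this, g1, g2]; module
    have k2 : (w - m) • (c - b) = 0 := by
      have : (w - m) • (c - b) = (e + w • (c - b)) - (e + v • (b - b)) - m • (c - b) := by module
      rw [this, g3, g2]; module
    have k3 : v - m = 0 := (smul_eq_zero.1 k1).resolve_right (sub_ne_zero.2 hab)
    have k4 : w - m = 0 := (smul_eq_zero.1 k2).resolve_right (sub_ne_zero.2 hbc.symm)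
    linarith
  rcases hind _ _ b1 b2 hsum with ⟨m, t, hm, e⟩ | ⟨m, t, hm, e⟩
  · apply hne
    refine fin c1 c2 m 0 t ?_ ?_ ?_
    · exact ext_homothetic hK b2 hnt hsum hm e h.ha (inc Sa) (inc Ta) (by module)
    · exact ext_homothetic hK b2 hnt hsum hm e h.hb (inc Sb) (inc Tb) (by module)
    · exact ext_homothetic hK b2 hnt hsum hm e h.hc (inc Sc) (inc Tc) (by module)
  · have hsum' := hsum
    rw [add_comm] at hsum'
    have : 1 - c1 = 1 - c2 := by
      refine fin (1 - c1) (1 - c2) m b t ?_ ?_ ?_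
      · exact ext_homothetic hK b1 hnt hsum' hm e h.ha (inc Ta) (inc Sa) (by module)
      · exact ext_homothetic hK b1 hnt hsum' hm e h.hb (inc Tb) (inc Sb) (by module)
      · exact ext_homothetic hK b1 hnt hsum' hm e h.hc (inc Tc) (inc Sc) (by module)
    apply hne; linarith

lemma of_ext_subset (hK : IsConvexBody K) {x y z : Fin 2 → ℝ} (hx : x ∈ K) (hy : y ∈ K) (hz : z ∈ K)
    (h : K.extremePoints ℝ ⊆ {x, y, z}) : K = convexHull ℝ {x, y, z} := by
  apply subset_antisymm
  · nth_rw 1 [← closure_convexHull_extremePoints hK.2.1 hK.2.2]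
    refine closure_minimal (convexHull_mono h) ?_
    exact (Set.Finite.isCompact_convexHull ℝ (Set.toFinite {x, y, z})).isClosed
  · refine convexHull_min ?_ hK.2.2
    rintro p (rfl | rfl | rfl) <;> assumption
end Plane

/-- A convex body in the plane is indecomposable iff it is a point, a line segment,
or a triangle, i.e. the convex hull of at most three points. -/
theorem stmt0 (K : Set (Fin 2 → ℝ)) (hK : IsConvexBody K) :
    Indecomposable K ↔ ∃ x y z : Fin 2 → ℝ, K = convexHull ℝ {x, y, z} := by
  constructor
  · intro hind
    by_contra hno
    obtain ⟨x, hx⟩ := hK.2.1.extremePoints_nonempty hK.1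
    have step : ∀ y ∈ K.extremePoints ℝ, ∀ z ∈ K.extremePoints ℝ,
        ∃ w ∈ K.extremePoints ℝ, w ≠ x ∧ w ≠ y ∧ w ≠ z := by
      intro y hy z hz
      by_contra hc
      push Not at hc
      refine hno ⟨x, y, z, of_ext_subset hK hx.1 hy.1 hz.1 fun w hw => ?_⟩
      by_cases h1 : w = x
      · simp [h1]
      by_cases h2 : w = y
      · simp [h2]
      · simp [hc w hw h1 h2]
    obtain ⟨y, hy, hyx, -, -⟩ := step x hx x hx
    obtain ⟨z, hz, hzx, hzy, -⟩ := step y hy y hy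
    obtain ⟨w, hw, hwx, hwy, hwz⟩ := step y hy z hz
    obtain ⟨o, a, b, c, d, k, l, h, hab, hbc⟩ := exists_cfg hK.2.2 ![x, y, z, w]
      (by intro i; fin_cases i <;> simpa) (by
        intro i j hij
        fin_cases i <;> fin_cases j <;> simp_all [eq_comm])
    exact four_dec hK h hab hbc hind
  · rintro ⟨x, y, z, rfl⟩
    exact tri_indec x y z
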